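/- Let Λ be a finitely aligned k-graph and let 𝓔 ⊆ FE(Λ). Every relative Cuntz-Krieger (Λ;𝓔)-family is a relative Cuntz-Krieger (Λ;𝓔̄)-family; that is, if {t_λ : λ ∈ Λ} satisfies (TCK1)–(TCK3) and (CK) for 𝓔, then ∏_{λ∈F}(t_{r(F)} − t_λt_λ*) = 0 for every F in the satiation 𝓔̄ of 𝓔. -/

import Mathlib

open scoped ENNReal

attribute [local instance] Classical.propDecidable

/-- Product of `f` over a set `S`, in some arbitrary order (junk value `1` if `S` is
infinite).  Used for products of commuting projections. -/
noncomputable def listProd {ι A : Type*} [Monoid A] (S : Set ι) (f : ι → A) : A :=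
  if h : S.Finite then (h.toFinset.toList.map f).prod else 1

/-- A `k`-graph: a countable category `Λ` (whose morphisms are the terms of `Path`, with
vertices identified with the morphisms of degree `0`) together with a degree functor
`d : Λ → ℕ^k` satisfying the factorisation property. -/
structure KGraph (k : ℕ) where
  Path : Type
  countable : Countable Path
  d : Path → Fin k → ℕ
  r : Path → Path
  s : Path → Path
  comp : Path → Path → Path
  d_r : ∀ lam, d (r lam) = 0
  d_s : ∀ lam, d (s lam) = 0
  r_r : ∀ lam, r (r lam) = r lam
  s_r : ∀ lam, s (r lam) = r lam
  r_s : ∀ lam, r (s lam) = s lam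
  s_s : ∀ lam, s (s lam) = s lam
  comp_source : ∀ lam, comp lam (s lam) = lam
  range_comp : ∀ lam, comp (r lam) lam = lam
  r_comp : ∀ lam mu, s lam = r mu → r (comp lam mu) = r lam
  s_comp : ∀ lam mu, s lam = r mu → s (comp lam mu) = s mu
  d_comp : ∀ lam mu, s lam = r mu → d (comp lam mu) = d lam + d mu
  comp_assoc : ∀ lam mu nu, s lam = r mu → s mu = r nu →
    comp (comp lam mu) nu = comp lam (comp mu nu)
  factor : ∀ lam m n, d lam = m + n →
    ∃! p : Path × Path, s p.1 = r p.2 ∧ d p.1 = m ∧ d p.2 = n ∧ comp p.1 p.2 = lam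

namespace KGraph

variable {k : ℕ} (Λ : KGraph k)

/-- Vertices are identified with the paths of degree `0`. -/
def IsVertex (v : Λ.Path) : Prop := Λ.d v = 0

/-- The unique factorisation of `lam` as a product of a path of degree `m` and the
remaining tail (junk value if `¬ m ≤ d lam`). -/
noncomputable def split (lam : Λ.Path) (m : Fin k → ℕ) : Λ.Path × Λ.Path :=
  if h : m ≤ Λ.d lam then
    (Λ.factor lam m (Λ.d lam - m) (by
      funext i
      exact (Nat.add_sub_cancel' (h i)).symm)).choose
  else (lam, lam)

/-- The segment `λ(m,n)` of the path `λ`: the unique path of degree `n - m` such that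
`λ = λ(0,m) λ(m,n) λ(n, d λ)` (meaningful for `m ≤ n ≤ d λ`). -/
noncomputable def seg (lam : Λ.Path) (m n : Fin k → ℕ) : Λ.Path :=
  (Λ.split (Λ.split lam n).1 m).2

/-- `MCE(μ,ν)`: minimal common extensions of `μ` and `ν`. -/
def MCE (mu nu : Λ.Path) : Set Λ.Path :=
  {lam | Λ.d lam = Λ.d mu ⊔ Λ.d nu ∧ Λ.seg lam 0 (Λ.d mu) = mu ∧ Λ.seg lam 0 (Λ.d nu) = nu}

/-- `Λ^min(μ,ν) = {(α,β) : μα = νβ ∈ MCE(μ,ν)}`. -/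
def Lmin (mu nu : Λ.Path) : Set (Λ.Path × Λ.Path) :=
  {p | Λ.s mu = Λ.r p.1 ∧ Λ.s nu = Λ.r p.2 ∧ Λ.comp mu p.1 = Λ.comp nu p.2 ∧
    Λ.comp mu p.1 ∈ Λ.MCE mu nu}

/-- `Ext(μ;E)`: extensions of `μ` with respect to `E`. -/
def Ext (mu : Λ.Path) (E : Set Λ.Path) : Set Λ.Path :=
  {a | Λ.r a = Λ.s mu ∧ ∃ nu ∈ E, ∃ b, (a, b) ∈ Λ.Lmin mu nu}

/-- `Λ` is finitely aligned if all the sets `MCE(μ,ν)` are finite. -/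
def FinitelyAligned : Prop := ∀ mu nu, (Λ.MCE mu nu).Finite

/-- `E ⊆ vΛ` is exhaustive if `Ext(λ;E) ≠ ∅` for all `λ ∈ vΛ`. -/
def Exhaustive (v : Λ.Path) (E : Set Λ.Path) : Prop :=
  ∀ lam, Λ.r lam = v → (Λ.Ext lam E).Nonempty

/-- `E ∈ vFE(Λ)`: `E ⊆ vΛ \ {v}` is finite and exhaustive (so `r(E) = v`). -/
def FEat (v : Λ.Path) (E : Set Λ.Path) : Prop :=
  Λ.IsVertex v ∧ (∀ lam ∈ E, Λ.r lam = v ∧ lam ≠ v) ∧ E.Finite ∧ Λ.Exhaustive v E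

/-- `FE(Λ)`: the finite exhaustive sets. -/
def FE : Set (Set Λ.Path) := {E | ∃ v, Λ.FEat v E}

/-- `λE = {λμ : μ ∈ E, r(μ) = s(λ)}`. -/
def lamSet (lam : Λ.Path) (E : Set Λ.Path) : Set Λ.Path :=
  {x | ∃ mu ∈ E, Λ.s lam = Λ.r mu ∧ Λ.comp lam mu = x}

/-- `EΛ = {λμ : λ ∈ E, r(μ) = s(λ)}`. -/
def setLam (E : Set Λ.Path) : Set Λ.Path :=
  {x | ∃ lam ∈ E, ∃ mu, Λ.s lam = Λ.r mu ∧ Λ.comp lam mu = x}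

/-- `𝓔 ⊆ FE(Λ)` is satiated if it satisfies (S1)--(S4). -/
def Satiated (𝓔 : Set (Set Λ.Path)) : Prop :=
  𝓔 ⊆ Λ.FE ∧
  (∀ G ∈ 𝓔, ∀ E ∈ Λ.FE, G ⊆ E → E ∈ 𝓔) ∧
  (∀ G ∈ 𝓔, ∀ v, Λ.FEat v G → ∀ mu, Λ.r mu = v → mu ∉ Λ.setLam G → Λ.Ext mu G ∈ 𝓔) ∧
  (∀ G ∈ 𝓔, ∀ n : Λ.Path → Fin k → ℕ, (∀ lam ∈ G, 0 < n lam ∧ n lam ≤ Λ.d lam) →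
    ((fun lam => Λ.seg lam 0 (n lam)) '' G) ∈ 𝓔) ∧
  (∀ G ∈ 𝓔, ∀ G' ⊆ G, ∀ Gl : Λ.Path → Set Λ.Path,
    (∀ lam ∈ G', Gl lam ∈ 𝓔 ∧ Λ.FEat (Λ.s lam) (Gl lam)) →
    ((G \ G') ∪ ⋃ lam ∈ G', Λ.lamSet lam (Gl lam)) ∈ 𝓔)

/-- The satiation `𝓔̄` of `𝓔`: the smallest satiated subset of `FE(Λ)` containing `𝓔`. -/
def satiation (𝓔 : Set (Set Λ.Path)) : Set (Set Λ.Path) :=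
  ⋂₀ {F | 𝓔 ⊆ F ∧ Λ.Satiated F}

/-- `ΠE`: the smallest subset of `Λ` containing `E` which is closed under the operation
`(λ,μ,σ) ↦ λ Ext(μ;{σ})` for `λ,μ,σ ∈ ΠE` with `d(λ) = d(μ)`, `s(λ) = s(μ)`. -/
def PiSet (E : Set Λ.Path) : Set Λ.Path :=
  ⋂₀ {G | E ⊆ G ∧ ∀ lam mu sig, lam ∈ G → mu ∈ G → sig ∈ G →
    Λ.d lam = Λ.d mu → Λ.s lam = Λ.s mu → Λ.lamSet lam (Λ.Ext mu {sig}) ⊆ G}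

/-- `Σ₁(𝓔)`: finite sets `F ⊆ r(E)Λ \ Λ⁰` containing some `E ∈ 𝓔`. -/
def Sig1 (𝓔 : Set (Set Λ.Path)) : Set (Set Λ.Path) :=
  {F | ∃ E ∈ 𝓔, ∃ v, Λ.FEat v E ∧ E ⊆ F ∧ F.Finite ∧
    ∀ lam ∈ F, Λ.r lam = v ∧ ¬ Λ.IsVertex lam}

/-- `Σ₂(𝓔) = {Ext(μ;E) : E ∈ 𝓔, μ ∈ r(E)Λ \ EΛ}`. -/
def Sig2 (𝓔 : Set (Set Λ.Path)) : Set (Set Λ.Path) :=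
  {F | ∃ E ∈ 𝓔, ∃ v, Λ.FEat v E ∧ ∃ mu, Λ.r mu = v ∧ mu ∉ Λ.setLam E ∧ F = Λ.Ext mu E}

/-- `Σ₃(𝓔) = {{λ(0,n_λ) : λ ∈ E} : E ∈ 𝓔, 0 < n_λ ≤ d(λ)}`. -/
def Sig3 (𝓔 : Set (Set Λ.Path)) : Set (Set Λ.Path) :=
  {F | ∃ E ∈ 𝓔, ∃ n : Λ.Path → Fin k → ℕ, (∀ lam ∈ E, 0 < n lam ∧ n lam ≤ Λ.d lam) ∧
    F = (fun lam => Λ.seg lam 0 (n lam)) '' E}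

/-- `Σ₄(𝓔) = {(E \ F) ∪ ⋃_{λ ∈ F} λ F_λ : E ∈ 𝓔, F ⊆ E, F_λ ∈ s(λ)𝓔}`. -/
def Sig4 (𝓔 : Set (Set Λ.Path)) : Set (Set Λ.Path) :=
  {G | ∃ E ∈ 𝓔, ∃ F ⊆ E, ∃ Fl : Λ.Path → Set Λ.Path,
    (∀ lam ∈ F, Fl lam ∈ 𝓔 ∧ Λ.FEat (Λ.s lam) (Fl lam)) ∧
    G = (E \ F) ∪ ⋃ lam ∈ F, Λ.lamSet lam (Fl lam)}

/-- `Σ = Σ₄ ∘ Σ₃ ∘ Σ₂ ∘ Σ₁`. -/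
def SigmaStep (𝓔 : Set (Set Λ.Path)) : Set (Set Λ.Path) :=
  Λ.Sig4 (Λ.Sig3 (Λ.Sig2 (Λ.Sig1 𝓔)))

/-- `Σ^∞(𝓔) = ⋃_{n ≥ 1} Σ^n(𝓔)`. -/
def SigmaInf (𝓔 : Set (Set Λ.Path)) : Set (Set Λ.Path) :=
  ⋃ n : ℕ, (Λ.SigmaStep)^[n + 1] 𝓔

section StarAlgebra

variable {A : Type*} [Ring A] [StarRing A]

/-- The product `∏_{λ ∈ E} (t_v - t_λ t_λ*)` (the factors pairwise commute for any
family satisfying (TCK1)--(TCK3), so the implicit choice of ordering is immaterial). -/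
noncomputable def gapProd (t : Λ.Path → A) (v : Λ.Path) (E : Set Λ.Path) : A :=
  listProd E fun lam => t v - t lam * star (t lam)

/-- Conditions (TCK1)--(TCK3) on a family `{t_λ}`. -/
def TCKFamily (t : Λ.Path → A) : Prop :=
  (∀ v, Λ.IsVertex v → star (t v) = t v ∧ t v * t v = t v) ∧
  (∀ v w, Λ.IsVertex v → Λ.IsVertex w → v ≠ w → t v * t w = 0) ∧
  (∀ lam mu, Λ.s lam = Λ.r mu → t lam * t mu = t (Λ.comp lam mu)) ∧
  (∀ lam mu, star (t lam) * t mu = ∑ᶠ p ∈ Λ.Lmin lam mu, t p.1 * star (t p.2))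

/-- A relative Cuntz-Krieger `(Λ;𝓔)`-family: (TCK1)--(TCK3) together with (CK). -/
def RCKFamily (𝓔 : Set (Set Λ.Path)) (t : Λ.Path → A) : Prop :=
  Λ.TCKFamily t ∧ ∀ E ∈ 𝓔, ∀ v, Λ.FEat v E → Λ.gapProd t v E = 0

/-- `Θ(t)^{ΠE}_{λ,μ} = t_λ (∏_{λν ∈ ΠE, d(ν) > 0} (t_{s(λ)} - t_ν t_ν*)) t_μ*`. -/
noncomputable def Theta (t : Λ.Path → A) (E : Set Λ.Path) (lam mu : Λ.Path) : A :=
  t lam *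
    listProd {nu | Λ.s lam = Λ.r nu ∧ ¬ Λ.IsVertex nu ∧ Λ.comp lam nu ∈ Λ.PiSet E}
      (fun nu => t (Λ.s lam) - t nu * star (t nu)) *
    star (t mu)

end StarAlgebra

end KGraph

/-- A graph morphism `x : Ω_{k,m} → Λ`, encoded by its length `m = d(x) ∈ (ℕ∪{∞})^k`
and its values `x(p,q)` on the morphisms `(p,q)` of `Ω_{k,m}` (with the junk value
`x(0,0)` outside the meaningful domain, so graph morphisms are extensional). -/
structure GMor {k : ℕ} (Λ : KGraph k) where
  len : Fin k → ℕ∞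
  seg : (Fin k → ℕ) → (Fin k → ℕ) → Λ.Path
  d_seg : ∀ p q, p ≤ q → (∀ i, (q i : ℕ∞) ≤ len i) → Λ.d (seg p q) = q - p
  r_seg : ∀ p q, p ≤ q → (∀ i, (q i : ℕ∞) ≤ len i) → Λ.r (seg p q) = seg p p
  s_seg : ∀ p q, p ≤ q → (∀ i, (q i : ℕ∞) ≤ len i) → Λ.s (seg p q) = seg q q
  comp_seg : ∀ p q u, p ≤ q → q ≤ u → (∀ i, (u i : ℕ∞) ≤ len i) →
    Λ.comp (seg p q) (seg q u) = seg p u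
  seg_junk : ∀ p q, ¬ (p ≤ q ∧ ∀ i, (q i : ℕ∞) ≤ len i) → seg p q = seg 0 0

namespace GMor

variable {k : ℕ} {Λ : KGraph k}

/-- The range `r(x) = x(0)` of a graph morphism. -/
def range (x : GMor Λ) : Λ.Path := x.seg 0 0

/-- `y = x|_n^{d(x)}`, the restriction of `x` (defined for `n ≤ d(x)`):
`d(y) = d(x) - n` and `y(p,q) = x(n+p, n+q)`. -/
def IsRestriction (y x : GMor Λ) (n : Fin k → ℕ) : Prop :=
  (∀ i, y.len i = x.len i - (n i : ℕ∞)) ∧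
  ∀ p q, p ≤ q → (∀ i, (q i : ℕ∞) ≤ y.len i) → y.seg p q = x.seg (n + p) (n + q)

/-- `y = λx`, the extension of `x` by `λ ∈ Λ r(x)`: `d(y) = d(λ) + d(x)`,
`y(0, d(λ)) = λ` and `y(d(λ), d(λ)+n) = x(0,n)` for `n ≤ d(x)`. -/
def IsExtension (y : GMor Λ) (lam : Λ.Path) (x : GMor Λ) : Prop :=
  (∀ i, y.len i = (Λ.d lam i : ℕ∞) + x.len i) ∧
  y.seg 0 (Λ.d lam) = lam ∧
  ∀ n : Fin k → ℕ, (∀ i, (n i : ℕ∞) ≤ x.len i) →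
    y.seg (Λ.d lam) (Λ.d lam + n) = x.seg 0 n

/-- `x ∈ FΛ^∞`: `x` has an initial segment belonging to `F`. -/
def HasInit (x : GMor Λ) (F : Set Λ.Path) : Prop :=
  ∃ lam ∈ F, (∀ i, (Λ.d lam i : ℕ∞) ≤ x.len i) ∧ x.seg 0 (Λ.d lam) = lam

/-- `z` restricts to `x` on `Ω_{k, d(x)}`. -/
def Agrees (z x : GMor Λ) : Prop :=
  ∀ p q, p ≤ q → (∀ i, (q i : ℕ∞) ≤ x.len i) → z.seg p q = x.seg p q

/-- `z ∈ MCE(x,y)` for graph morphisms `x, y`. -/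
def IsMCE (z x y : GMor Λ) : Prop :=
  (∀ i, z.len i = max (x.len i) (y.len i)) ∧ z.Agrees x ∧ z.Agrees y

/-- `x` is aperiodic: for distinct `λ, μ ∈ Λ r(x)`, `MCE(λx, μx) = ∅`. -/
def Aperiodic (x : GMor Λ) : Prop :=
  ∀ lam mu : Λ.Path, lam ≠ mu → Λ.s lam = x.range → Λ.s mu = x.range →
    ∀ lx mx : GMor Λ, lx.IsExtension lam x → mx.IsExtension mu x →
      ∀ z : GMor Λ, ¬ z.IsMCE lx mx

end GMor

namespace KGraph

variable {k : ℕ} (Λ : KGraph k)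

/-- `x ∈ ∂(Λ;𝓔)`: an `𝓔`-compatible boundary path. -/
def IsBdry (𝓔 : Set (Set Λ.Path)) (x : GMor Λ) : Prop :=
  ∀ n : Fin k → ℕ, (∀ i, (n i : ℕ∞) ≤ x.len i) →
    ∀ E ∈ 𝓔, Λ.FEat (x.seg n n) E →
      ∃ lam ∈ E, (∀ i, ((n + Λ.d lam) i : ℕ∞) ≤ x.len i) ∧ x.seg n (n + Λ.d lam) = lam

/-- Condition (C): aperiodic `𝓔`-compatible boundary paths out of every vertex, and
avoiding any given `F ∈ vFE(Λ) \ 𝓔`. -/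
def CondC (𝓔 : Set (Set Λ.Path)) : Prop :=
  (∀ v, Λ.IsVertex v → ∃ x : GMor Λ, Λ.IsBdry 𝓔 x ∧ x.range = v ∧ x.Aperiodic) ∧
  (∀ v F, Λ.FEat v F → F ∉ 𝓔 →
    ∃ x : GMor Λ, Λ.IsBdry 𝓔 x ∧ x.range = v ∧ ¬ x.HasInit F ∧ x.Aperiodic)

end KGraph

namespace KGraph

variable {k : ℕ} (Λ : KGraph k)

section Paths

variable {Λ}

theorem comp_inj {a b a' b' : Λ.Path} (h : Λ.s a = Λ.r b) (h' : Λ.s a' = Λ.r b')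
    (hd : Λ.d a = Λ.d a') (hc : Λ.comp a b = Λ.comp a' b') : a = a' ∧ b = b' := by
  have hb : Λ.d b = Λ.d b' := by
    have h1 := Λ.d_comp a b h
    rw [hc, Λ.d_comp a' b' h', hd] at h1
    exact (add_left_cancel h1).symm
  obtain ⟨p, -, hp⟩ := Λ.factor (Λ.comp a b) (Λ.d a) (Λ.d b) (Λ.d_comp a b h)
  have h1 := hp (a, b) ⟨h, rfl, rfl, rfl⟩
  have h2 := hp (a', b') ⟨h', hd.symm, hb.symm, hc.symm⟩
  exact Prod.ext_iff.mp (h1.trans h2.symm)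

theorem IsVertex.r_eq {v : Λ.Path} (hv : Λ.IsVertex v) : Λ.r v = v :=
  (comp_inj (Λ.s_r v) (Λ.r_s v).symm ((Λ.d_r v).trans hv.symm)
    ((Λ.range_comp v).trans (Λ.comp_source v).symm)).1

theorem IsVertex.s_eq {v : Λ.Path} (hv : Λ.IsVertex v) : Λ.s v = v := by
  rw [← hv.r_eq, Λ.s_r]

theorem split_spec (lam : Λ.Path) {m : Fin k → ℕ} (h : m ≤ Λ.d lam) :
    Λ.s (Λ.split lam m).1 = Λ.r (Λ.split lam m).2 ∧ Λ.d (Λ.split lam m).1 = m ∧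
      Λ.comp (Λ.split lam m).1 (Λ.split lam m).2 = lam := by
  have hd : Λ.d lam = m + (Λ.d lam - m) := by
    funext i
    exact (Nat.add_sub_cancel' (h i)).symm
  have hs := (Λ.factor lam m (Λ.d lam - m) hd).choose_spec.1
  rw [split, dif_pos h]
  exact ⟨hs.1, hs.2.1, hs.2.2.2⟩

theorem seg_zero (lam : Λ.Path) (n : Fin k → ℕ) :
    Λ.seg lam 0 n = (Λ.split lam n).1 := by
  rw [seg]
  obtain ⟨hs, hd, hc⟩ := split_spec (Λ.split lam n).1 (zero_le : (0 : Fin k → ℕ) ≤ _)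
  have hv : Λ.IsVertex (Λ.split (Λ.split lam n).1 0).1 := hd
  rw [hv.s_eq] at hs
  rw [hs, Λ.range_comp] at hc
  exact hc

theorem exists_comp_seg (lam : Λ.Path) {n : Fin k → ℕ} (h : n ≤ Λ.d lam) :
    Λ.d (Λ.seg lam 0 n) = n ∧
      ∃ a, Λ.s (Λ.seg lam 0 n) = Λ.r a ∧ Λ.comp (Λ.seg lam 0 n) a = lam := by
  rw [seg_zero lam n]
  obtain ⟨hs, hd, hc⟩ := split_spec lam h
  exact ⟨hd, _, hs, hc⟩

theorem seg_comp {a b : Λ.Path} (h : Λ.s a = Λ.r b) :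
    Λ.seg (Λ.comp a b) 0 (Λ.d a) = a := by
  have hle : Λ.d a ≤ Λ.d (Λ.comp a b) := by
    rw [Λ.d_comp a b h]
    exact le_self_add
  obtain ⟨hd, c, hs, hc⟩ := exists_comp_seg (Λ.comp a b) hle
  exact (comp_inj hs h hd hc).1

theorem mem_Lmin {mu nu a b : Λ.Path} : (a, b) ∈ Λ.Lmin mu nu ↔
    Λ.s mu = Λ.r a ∧ Λ.s nu = Λ.r b ∧ Λ.comp mu a = Λ.comp nu b ∧
      Λ.d (Λ.comp mu a) = Λ.d mu ⊔ Λ.d nu := by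
  constructor
  · rintro ⟨h1, h2, h3, h4⟩
    exact ⟨h1, h2, h3, h4.1⟩
  · rintro ⟨h1, h2, h3, h4⟩
    refine ⟨h1, h2, h3, h4, seg_comp h1, ?_⟩
    change Λ.seg (Λ.comp mu a) 0 (Λ.d nu) = nu
    rw [h3]
    exact seg_comp h2

theorem Lmin_finite (hΛ : Λ.FinitelyAligned) (mu nu : Λ.Path) : (Λ.Lmin mu nu).Finite := by
  refine Set.Finite.of_finite_image (f := fun p => Λ.comp mu p.1)
    ((hΛ mu nu).subset ?_) ?_
  · rintro _ ⟨p, hp, rfl⟩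
    exact hp.2.2.2
  · rintro ⟨a, b⟩ hp ⟨a', b'⟩ hq h
    obtain ⟨h1, h2, h3, -⟩ := mem_Lmin.mp hp
    obtain ⟨h1', h2', h3', -⟩ := mem_Lmin.mp hq
    exact Prod.ext (comp_inj h1 h1' rfl h).2
      (comp_inj h2 h2' rfl (h3.symm.trans (h.trans h3'))).2

theorem Lmin_self (lam : Λ.Path) : Λ.Lmin lam lam = {(Λ.s lam, Λ.s lam)} := by
  ext ⟨a, b⟩
  rw [mem_Lmin, Set.mem_singleton_iff, sup_idem]
  constructor
  · rintro ⟨h1, h2, h3, h4⟩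
    rw [Λ.d_comp lam a h1] at h4
    have ha : Λ.IsVertex a := add_eq_left.mp h4
    have hab := (comp_inj h1 h2 rfl h3).2
    rw [← hab, h1, ha.r_eq]
  · rintro h
    obtain ⟨rfl, rfl⟩ := Prod.ext_iff.mp h
    simp [Λ.r_s, Λ.comp_source]

/-- Every common extension of `mu` and `nu` factors through a minimal one. -/
theorem exists_Lmin_of_comp_eq {mu nu x y : Λ.Path} (hx : Λ.s mu = Λ.r x)
    (hy : Λ.s nu = Λ.r y) (h : Λ.comp mu x = Λ.comp nu y) :
    ∃ a b c, (a, b) ∈ Λ.Lmin mu nu ∧ Λ.s a = Λ.r c ∧ Λ.comp a c = x := by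
  have hm : Λ.d mu ≤ Λ.d (Λ.comp mu x) := by
    rw [Λ.d_comp _ _ hx]
    exact le_self_add
  have hn : Λ.d nu ≤ Λ.d (Λ.comp mu x) := by
    rw [h, Λ.d_comp _ _ hy]
    exact le_self_add
  obtain ⟨hd, c, hs, hc⟩ := exists_comp_seg (Λ.comp mu x) (sup_le hm hn)
  set z := Λ.seg (Λ.comp mu x) 0 (Λ.d mu ⊔ Λ.d nu)
  obtain ⟨hda, a, hsa, hca⟩ := exists_comp_seg z (n := Λ.d mu) (hd ▸ le_sup_left)
  obtain ⟨hdb, b, hsb, hcb⟩ := exists_comp_seg z (n := Λ.d nu) (hd ▸ le_sup_right)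
  set z₁ := Λ.seg z 0 (Λ.d mu)
  set z₂ := Λ.seg z 0 (Λ.d nu)
  have hac : Λ.s a = Λ.r c := by rw [← hs, ← hca, Λ.s_comp _ _ hsa]
  have hbc : Λ.s b = Λ.r c := by rw [← hs, ← hcb, Λ.s_comp _ _ hsb]
  have e1 : z₁ = mu ∧ Λ.comp a c = x := by
    refine comp_inj (by rw [Λ.r_comp _ _ hac, hsa]) hx hda ?_
    rw [← Λ.comp_assoc _ _ _ hsa hac, hca, hc]
  have e2 : z₂ = nu ∧ Λ.comp b c = y := by
    refine comp_inj (by rw [Λ.r_comp _ _ hbc, hsb]) hy hdb ?_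
    rw [← Λ.comp_assoc _ _ _ hsb hbc, hcb, hc, h]
  rw [e1.1] at hsa hca
  rw [e2.1] at hsb hcb
  exact ⟨a, b, c, mem_Lmin.mpr ⟨hsa, hsb, hca.trans hcb.symm, by rw [hca, hd]⟩, hac, e1.2⟩

theorem Ext_nonempty_iff {lam : Λ.Path} {E : Set Λ.Path} : (Λ.Ext lam E).Nonempty ↔
    ∃ nu ∈ E, ∃ a b, Λ.s lam = Λ.r a ∧ Λ.s nu = Λ.r b ∧ Λ.comp lam a = Λ.comp nu b := by
  constructor
  · rintro ⟨a, -, nu, hnu, b, hab⟩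
    obtain ⟨h1, h2, h3, -⟩ := mem_Lmin.mp hab
    exact ⟨nu, hnu, a, b, h1, h2, h3⟩
  · rintro ⟨nu, hnu, x, y, hx, hy, h⟩
    obtain ⟨a, b, c, hab, -, -⟩ := exists_Lmin_of_comp_eq hx hy h
    exact ⟨a, (mem_Lmin.mp hab).1.symm, nu, hnu, b, hab⟩

theorem FEat.nonempty {v : Λ.Path} {E : Set Λ.Path} (h : Λ.FEat v E) : E.Nonempty := by
  obtain ⟨nu, hnu, -⟩ := Ext_nonempty_iff.mp (h.2.2.2 v h.1.r_eq)
  exact ⟨nu, hnu⟩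

theorem FEat.eq_of_subset {v w : Λ.Path} {E F : Set Λ.Path} (hE : Λ.FEat v E)
    (hF : Λ.FEat w F) (h : E ⊆ F) : v = w := by
  obtain ⟨lam, hlam⟩ := hE.nonempty
  rw [← (hE.2.1 lam hlam).1, (hF.2.1 lam (h hlam)).1]

theorem FEat.Ext (hΛ : Λ.FinitelyAligned) {v mu : Λ.Path} {G : Set Λ.Path}
    (hG : Λ.FEat v G) (hr : Λ.r mu = v) (hmu : mu ∉ Λ.setLam G) :
    Λ.FEat (Λ.s mu) (Λ.Ext mu G) := by
  refine ⟨Λ.d_s mu, ?_, ?_, ?_⟩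
  · rintro a ⟨ha, nu, hnu, b, hab⟩
    refine ⟨ha, ?_⟩
    rintro rfl
    obtain ⟨-, h2, h3, -⟩ := mem_Lmin.mp hab
    rw [Λ.comp_source] at h3
    exact hmu ⟨nu, hnu, b, h2, h3.symm⟩
  · refine (hG.2.2.1.biUnion fun nu _ => (Lmin_finite hΛ mu nu).image Prod.fst).subset ?_
    rintro a ⟨-, nu, hnu, b, hab⟩
    exact Set.mem_biUnion hnu ⟨(a, b), hab, rfl⟩
  · intro lam hlam
    obtain ⟨nu, hnu, x, y, hx, hy, h⟩ :=
      Ext_nonempty_iff.mp (hG.2.2.2 (Λ.comp mu lam) (by rw [Λ.r_comp _ _ hlam.symm, hr]))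
    rw [Λ.s_comp _ _ hlam.symm] at hx
    rw [Λ.comp_assoc _ _ _ hlam.symm hx] at h
    obtain ⟨a, b, c, hab, hac, hc⟩ :=
      exists_Lmin_of_comp_eq (by rw [Λ.r_comp _ _ hx, hlam]) hy h
    exact Ext_nonempty_iff.mpr
      ⟨a, ⟨(mem_Lmin.mp hab).1.symm, nu, hnu, b, hab⟩, x, c, hx, hac, hc.symm⟩

theorem FEat.image_seg {v : Λ.Path} {G : Set Λ.Path} (hG : Λ.FEat v G)
    {n : Λ.Path → Fin k → ℕ} (hn : ∀ lam ∈ G, 0 < n lam ∧ n lam ≤ Λ.d lam) :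
    Λ.FEat v ((fun lam => Λ.seg lam 0 (n lam)) '' G) := by
  refine ⟨hG.1, ?_, hG.2.2.1.image _, ?_⟩
  · rintro _ ⟨lam, hlam, rfl⟩
    obtain ⟨hd, a, hs, hc⟩ := exists_comp_seg lam (hn lam hlam).2
    constructor
    · have h := Λ.r_comp _ _ hs
      rw [hc, (hG.2.1 lam hlam).1] at h
      exact h.symm
    · intro h
      have h0 : Λ.d v = n lam := h ▸ hd
      exact (hn lam hlam).1.ne (Eq.trans (Eq.symm hG.1) h0)
  · intro kap hkap
    obtain ⟨lam, hlam, x, y, hx, hy, h⟩ := Ext_nonempty_iff.mp (hG.2.2.2 kap hkap)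
    obtain ⟨-, a, hs, hc⟩ := exists_comp_seg lam (hn lam hlam).2
    have hay : Λ.s a = Λ.r y := by rw [← hy, ← Λ.s_comp _ _ hs, hc]
    refine Ext_nonempty_iff.mpr ⟨_, ⟨lam, hlam, rfl⟩, x, Λ.comp a y, hx, ?_, ?_⟩
    · rw [Λ.r_comp _ _ hay]
      exact hs
    · change _ = Λ.comp (Λ.seg lam 0 (n lam)) (Λ.comp a y)
      rw [← Λ.comp_assoc _ _ _ hs hay, hc, h]

theorem FEat.refine {v : Λ.Path} {G G' : Set Λ.Path} (hG : Λ.FEat v G) (hG' : G' ⊆ G)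
    {Gl : Λ.Path → Set Λ.Path} (hGl : ∀ lam ∈ G', Λ.FEat (Λ.s lam) (Gl lam)) :
    Λ.FEat v ((G \ G') ∪ ⋃ lam ∈ G', Λ.lamSet lam (Gl lam)) := by
  refine ⟨hG.1, ?_, ?_, ?_⟩
  · rintro x (hx | hx)
    · exact hG.2.1 x hx.1
    · obtain ⟨lam, hlam, mu, hmu, hs, rfl⟩ := Set.mem_iUnion₂.mp hx
      refine ⟨by rw [Λ.r_comp _ _ hs, (hG.2.1 lam (hG' hlam)).1], fun h => ?_⟩
      have hd : Λ.d lam + Λ.d mu = 0 := by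
        rw [← Λ.d_comp _ _ hs, h]
        exact hG.1
      have hv : Λ.IsVertex mu := (add_eq_zero.mp hd).2
      exact ((hGl lam hlam).2.1 mu hmu).2 (by rw [hs, hv.r_eq])
  · refine (hG.2.2.1.subset Set.sdiff_subset).union
      ((hG.2.2.1.subset hG').biUnion fun lam hlam => ?_)
    refine ((hGl lam hlam).2.2.1.image (Λ.comp lam)).subset ?_
    rintro _ ⟨mu, hmu, -, rfl⟩
    exact ⟨mu, hmu, rfl⟩
  · intro kap hkap
    obtain ⟨lam, hlam, x, y, hx, hy, h⟩ := Ext_nonempty_iff.mp (hG.2.2.2 kap hkap)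
    by_cases hl : lam ∈ G'
    · obtain ⟨mu, hmu, a, b, ha, hb, hab⟩ :=
        Ext_nonempty_iff.mp ((hGl lam hl).2.2.2 y hy.symm)
      have hs : Λ.s lam = Λ.r mu := ((hGl lam hl).2.1 mu hmu).1.symm
      have hxa : Λ.s x = Λ.r a := by
        rw [← ha, ← Λ.s_comp _ _ hx, h, Λ.s_comp _ _ hy]
      refine Ext_nonempty_iff.mpr ⟨Λ.comp lam mu,
        Or.inr (Set.mem_biUnion hl ⟨mu, hmu, hs, rfl⟩), Λ.comp x a, b, ?_, ?_, ?_⟩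
      · rw [Λ.r_comp _ _ hxa, hx]
      · rw [Λ.s_comp _ _ hs, hb]
      · rw [← Λ.comp_assoc _ _ _ hx hxa, h, Λ.comp_assoc _ _ _ hy ha, hab,
          Λ.comp_assoc _ _ _ hs hb]
    · exact Ext_nonempty_iff.mpr ⟨lam, Or.inl ⟨hlam, hl⟩, x, y, hx, hy, h⟩

end Paths

section Families

variable {Λ} {A : Type*} [Ring A] [StarRing A] {t : Λ.Path → A}

theorem TCKFamily.mul_source (ht : Λ.TCKFamily t) (lam : Λ.Path) :
    t lam * t (Λ.s lam) = t lam := by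
  rw [ht.2.2.1 _ _ (Λ.r_s lam).symm, Λ.comp_source]

theorem TCKFamily.range_mul (ht : Λ.TCKFamily t) (lam : Λ.Path) :
    t (Λ.r lam) * t lam = t lam := by
  rw [ht.2.2.1 _ _ (Λ.s_r lam), Λ.range_comp]

theorem TCKFamily.star_mul_range (ht : Λ.TCKFamily t) (lam : Λ.Path) :
    star (t lam) * t (Λ.r lam) = star (t lam) := by
  have h := congrArg star (ht.range_mul lam)
  rwa [star_mul, (ht.1 _ (Λ.d_r lam)).1] at h

theorem TCKFamily.star_mul_self (ht : Λ.TCKFamily t) (lam : Λ.Path) :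
    star (t lam) * t lam = t (Λ.s lam) := by
  rw [ht.2.2.2, Lmin_self, finsum_mem_singleton, (ht.1 _ (Λ.d_s lam)).1, (ht.1 _ (Λ.d_s lam)).2]

theorem TCKFamily.star_mul_eq_sum (hΛ : Λ.FinitelyAligned) (ht : Λ.TCKFamily t)
    (lam mu : Λ.Path) : star (t lam) * t mu =
      ∑ p ∈ (Lmin_finite hΛ lam mu).toFinset, t p.1 * star (t p.2) := by
  rw [ht.2.2.2, finsum_mem_eq_finite_toFinset_sum _ (Lmin_finite hΛ lam mu)]

theorem TCKFamily.commute (hΛ : Λ.FinitelyAligned) (ht : Λ.TCKFamily t) (lam mu : Λ.Path) :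
    Commute (t lam * star (t lam)) (t mu * star (t mu)) := by
  have key : t lam * star (t lam) * (t mu * star (t mu)) =
      ∑ p ∈ (Lmin_finite hΛ lam mu).toFinset,
        t (Λ.comp lam p.1) * star (t (Λ.comp lam p.1)) := by
    calc t lam * star (t lam) * (t mu * star (t mu))
        = t lam * (star (t lam) * t mu) * star (t mu) := by noncomm_ring
      _ = _ := by
        rw [ht.star_mul_eq_sum hΛ, Finset.mul_sum, Finset.sum_mul]
        refine Finset.sum_congr rfl fun p hp => ?_
        obtain ⟨h1, h2, h3, -⟩ :=
          mem_Lmin.mp (show (p.1, p.2) ∈ Λ.Lmin lam mu from (Set.Finite.mem_toFinset _).mp hp)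
        nth_rewrite 2 [h3]
        rw [← ht.2.2.1 _ _ h1, ← ht.2.2.1 _ _ h2, star_mul]
        noncomm_ring
  have hstar : star (t lam * star (t lam) * (t mu * star (t mu))) =
      t lam * star (t lam) * (t mu * star (t mu)) := by
    rw [key, star_sum]
    exact Finset.sum_congr rfl fun p _ => by rw [star_mul, star_star]
  rw [Commute, SemiconjBy, ← hstar]
  simp only [star_mul, star_star]

theorem mul_list_prod_eq_self {M : Type*} [Monoid M] {x : M} {l : List M}
    (h : ∀ y ∈ l, x * y = x) : x * l.prod = x := by
  induction l with
  | nil => simp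
  | cons a l ih =>
    rw [List.prod_cons, ← mul_assoc, h a (by simp)]
    exact ih fun y hy => h y (by simp [hy])

theorem list_prod_mul_eq_zero {R : Type*} [Ring R] {l : List R} {a y : R} (ha : a ∈ l)
    (hay : a * y = 0) (hc : ∀ b ∈ l, Commute b y) : l.prod * y = 0 := by
  induction l with
  | nil => simp at ha
  | cons b l ih =>
    rw [List.prod_cons, mul_assoc]
    rcases List.mem_cons.mp ha with rfl | h
    · have : Commute l.prod y :=
        Commute.list_prod_left l y fun c hc' => hc c (by simp [hc'])
      rw [this.eq, ← mul_assoc, hay, zero_mul]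
    · rw [ih h fun c hc' => hc c (by simp [hc']), mul_zero]

/-- The gap projection of `E` vanishes precisely when an element supported on `t v` that
annihilates every `t lam` with `lam ∈ E` must be zero. -/
theorem gapProd_eq_zero_iff (hΛ : Λ.FinitelyAligned) (ht : Λ.TCKFamily t) {v : Λ.Path}
    {E : Set Λ.Path} (hE : Λ.FEat v E) : Λ.gapProd t v E = 0 ↔
      ∀ x : A, x * t v = x → (∀ lam ∈ E, x * t lam = 0) → x = 0 := by
  have hfin : E.Finite := hE.2.2.1
  have hr : ∀ lam ∈ E, Λ.r lam = v := fun lam h => (hE.2.1 lam h).1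
  have hl : ∀ lam ∈ E, t v * t lam = t lam := fun lam h => hr lam h ▸ ht.range_mul lam
  have hsr : ∀ lam ∈ E, star (t lam) * t v = star (t lam) :=
    fun lam h => hr lam h ▸ ht.star_mul_range lam
  rw [gapProd, listProd, dif_pos hfin]
  constructor
  · intro h x hx hxE
    have hm : x * (hfin.toFinset.toList.map fun lam => t v - t lam * star (t lam)).prod = x := by
      refine mul_list_prod_eq_self fun y hy => ?_
      obtain ⟨lam, hlam, rfl⟩ := List.mem_map.mp hy
      rw [Finset.mem_toList, Set.Finite.mem_toFinset] at hlam
      rw [mul_sub, hx, ← mul_assoc, hxE lam hlam, zero_mul, sub_zero]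
    rw [← hm, h, mul_zero]
  · intro h
    have hcomm : ∀ lam ∈ E, Commute (t v) (t lam * star (t lam)) := fun lam hlam => by
      rw [Commute, SemiconjBy, ← mul_assoc, hl lam hlam, mul_assoc, hsr lam hlam]
    have hqq : ∀ lam, t lam * star (t lam) * (t lam * star (t lam)) = t lam * star (t lam) :=
      fun lam => by
        rw [mul_assoc, ← mul_assoc (star (t lam)), ht.star_mul_self, ← mul_assoc,
          ht.mul_source]
    have hzero : ∀ lam ∈ E,
        (hfin.toFinset.toList.map fun lam => t v - t lam * star (t lam)).prod *
          (t lam * star (t lam)) = 0 := by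
      intro lam hlam
      refine list_prod_mul_eq_zero (a := t v - t lam * star (t lam))
        (List.mem_map.mpr ⟨lam, by simpa using hlam, rfl⟩) ?_ ?_
      · rw [sub_mul, hqq, ← mul_assoc, hl lam hlam, sub_self]
      · intro b hb
        obtain ⟨mu, hmu, rfl⟩ := List.mem_map.mp hb
        exact (hcomm lam hlam).sub_left (ht.commute hΛ mu lam)
    have hann : ∀ lam ∈ E,
        (hfin.toFinset.toList.map fun lam => t v - t lam * star (t lam)).prod * t lam = 0 := by
      intro lam hlam
      rw [← ht.mul_source lam, ← ht.star_mul_self lam, ← mul_assoc (t lam), ← mul_assoc,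
        hzero lam hlam, zero_mul]
    refine h _ ?_ hann
    obtain ⟨lam, hlam⟩ := hE.nonempty
    have hmem : lam ∈ hfin.toFinset.toList := by simpa using hlam
    have h1 : (hfin.toFinset.toList.map fun lam => t v - t lam * star (t lam)).prod *
        (1 - t v) = 0 := by
      refine list_prod_mul_eq_zero (a := t v - t lam * star (t lam))
        (List.mem_map.mpr ⟨lam, hmem, rfl⟩) ?_ ?_
      · rw [mul_sub, mul_one, sub_mul, (ht.1 v hE.1).2, mul_assoc, hsr lam hlam, sub_self]
      · intro b hb
        obtain ⟨mu, hmu, rfl⟩ := List.mem_map.mp hb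
        rw [Finset.mem_toList, Set.Finite.mem_toFinset] at hmu
        exact (Commute.one_right _).sub_right
          ((Commute.refl (t v)).sub_left (hcomm mu hmu).symm)
    rw [mul_sub, mul_one] at h1
    exact (sub_eq_zero.mp h1).symm

/-- The finite exhaustive sets whose gap projection vanishes form a satiated family. -/
theorem satiated_gapProd_eq_zero (hΛ : Λ.FinitelyAligned) (ht : Λ.TCKFamily t) :
    Λ.Satiated {F | ∃ v, Λ.FEat v F ∧ Λ.gapProd t v F = 0} := by
  refine ⟨fun F ⟨v, hF, _⟩ => ⟨v, hF⟩, ?_, ?_, ?_, ?_⟩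
  · rintro G ⟨v, hG, h0⟩ E ⟨w, hE⟩ hGE
    obtain rfl := hG.eq_of_subset hE hGE
    refine ⟨v, hE, (gapProd_eq_zero_iff hΛ ht hE).mpr fun x hx hxE => ?_⟩
    exact (gapProd_eq_zero_iff hΛ ht hG).mp h0 x hx fun lam hlam => hxE lam (hGE hlam)
  · rintro G ⟨w, hG', h0⟩ v hG mu hr hmu
    obtain rfl := hG'.eq_of_subset hG subset_rfl
    have hE := hG.Ext hΛ hr hmu
    refine ⟨_, hE, (gapProd_eq_zero_iff hΛ ht hE).mpr fun x hx hxE => ?_⟩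
    have hy : x * star (t mu) = 0 := by
      refine (gapProd_eq_zero_iff hΛ ht hG).mp h0 _ ?_ fun nu hnu => ?_
      · rw [mul_assoc, ← hr, ht.star_mul_range]
      · rw [mul_assoc, ht.star_mul_eq_sum hΛ, Finset.mul_sum]
        refine Finset.sum_eq_zero fun p hp => ?_
        have hp' : (p.1, p.2) ∈ Λ.Lmin mu nu := (Set.Finite.mem_toFinset _).mp hp
        rw [← mul_assoc, hxE p.1 ⟨(mem_Lmin.mp hp').1.symm, nu, hnu, p.2, hp'⟩, zero_mul]
    rw [← hx, ← ht.star_mul_self, ← mul_assoc, hy, zero_mul]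
  · rintro G ⟨v, hG, h0⟩ n hn
    have hE := hG.image_seg hn
    refine ⟨v, hE, (gapProd_eq_zero_iff hΛ ht hE).mpr fun x hx hxE => ?_⟩
    refine (gapProd_eq_zero_iff hΛ ht hG).mp h0 x hx fun lam hlam => ?_
    obtain ⟨-, a, hs, hc⟩ := exists_comp_seg lam (hn lam hlam).2
    rw [← hc, ← ht.2.2.1 _ _ hs, ← mul_assoc, hxE _ ⟨lam, hlam, rfl⟩, zero_mul]
  · rintro G ⟨v, hG, h0⟩ G' hG' Gl hGl
    have hE := hG.refine hG' fun lam hlam => (hGl lam hlam).2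
    refine ⟨v, hE, (gapProd_eq_zero_iff hΛ ht hE).mpr fun x hx hxE => ?_⟩
    refine (gapProd_eq_zero_iff hΛ ht hG).mp h0 x hx fun lam hlam => ?_
    by_cases hl : lam ∈ G'
    · obtain ⟨⟨w, hw, hw0⟩, hF⟩ := hGl lam hl
      obtain rfl := hw.eq_of_subset hF subset_rfl
      refine (gapProd_eq_zero_iff hΛ ht hw).mp hw0 _ ?_ fun mu hmu => ?_
      · rw [mul_assoc, ht.mul_source]
      · have hs : Λ.s lam = Λ.r mu := (hw.2.1 mu hmu).1.symm
        rw [mul_assoc, ht.2.2.1 _ _ hs]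
        exact hxE _ (Or.inr (Set.mem_biUnion hl ⟨mu, hmu, hs, rfl⟩))
    · exact hxE lam (Or.inl ⟨hlam, hl⟩)

end Families

end KGraph

/-- Corollary 5.6: every relative Cuntz-Krieger `(Λ;𝓔)`-family is a
relative Cuntz-Krieger `(Λ;𝓔̄)`-family. -/
theorem statement13 {k : ℕ} (Λ : KGraph k) (hΛ : Λ.FinitelyAligned)
    (𝓔 : Set (Set Λ.Path)) (h𝓔 : 𝓔 ⊆ Λ.FE)
    {A : Type*} [NormedRing A] [StarRing A] [CStarRing A] [NormedAlgebra ℂ A]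
    [CompleteSpace A] [StarModule ℂ A]
    (t : Λ.Path → A) (ht : Λ.RCKFamily 𝓔 t) :
    ∀ F ∈ Λ.satiation 𝓔, ∀ v, Λ.FEat v F → Λ.gapProd t v F = 0 := by
  intro F hF v hv
  obtain ⟨w, hw, h0⟩ := Set.mem_sInter.mp hF {F | ∃ v, Λ.FEat v F ∧ Λ.gapProd t v F = 0}
    ⟨fun E hE => (h𝓔 hE).imp fun w hw => ⟨hw, ht.2 E hE w hw⟩,
      KGraph.satiated_gapProd_eq_zero hΛ ht.1⟩
  rwa [← hw.eq_of_subset hv subset_rfl]
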